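/- arXiv:math/0510484 — 2 statements merged into one kernel-verified Lean document; each statement's English description precedes it below -/
import Mathlib

section
/- A topological space X has the Hurewicz property Ufin(𝒪,Γ) if and only if for every sequence (u_n)_{n∈ℕ} of open covers of X there exist finite subfamilies v_n ⊆ u_n such that, setting w = (⋃v_n)_{n∈ℕ}, the family ↑μ_w(X) = {B ⊆ ℕ : μ_w(x) ⊆* B for some x ∈ X} is meager. -/
open Set Cardinal

/-- `A ⊆* B` : almost inclusion, i.e. `A \ B` is finite. -/
def AlmostSub (A B : Set ℕ) : Prop := (A \ B).Finite

/-- The Marczewski map: `mu u x = {n | x ∈ u n}`. -/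
def mu {X : Type*} (u : ℕ → Set X) (x : X) : Set ℕ := {n | x ∈ u n}

/-- `u` is a γ-cover: every `mu u x` is cofinite. -/
def IsGammaCover {X : Type*} (u : ℕ → Set X) : Prop :=
  ∀ x : X, (mu u x)ᶜ.Finite

/-- `u` is an ω-cover: the family `mu u '' X` is centered. -/
def IsOmegaCover {X : Type*} (u : ℕ → Set X) : Prop :=
  ∀ K : Finset X, (⋂ x ∈ K, mu u x).Infinite

/-- `u` is a τ-cover. -/
def IsTauCover {X : Type*} (u : ℕ → Set X) : Prop :=
  (∀ x : X, (mu u x).Infinite) ∧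
  ∀ x₁ x₂ : X, AlmostSub (mu u x₁) (mu u x₂) ∨ AlmostSub (mu u x₂) (mu u x₁)

/-- A family of sets of naturals is linearly preordered by `⊆*`. -/
def LinearAlmost (J : Set (Set ℕ)) : Prop :=
  ∀ A ∈ J, ∀ B ∈ J, AlmostSub A B ∨ AlmostSub B A

/-- `u` is a τ*-cover: some family `J` of infinite subsets of `ℕ`, linearly
preordered by `⊆*`, refines `mu u '' X`. -/
def IsTauAstCover {X : Type*} (u : ℕ → Set X) : Prop :=
  ∃ J : Set (Set ℕ), (∀ A ∈ J, A.Infinite) ∧ LinearAlmost J ∧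
    ∀ x : X, ∃ A ∈ J, A ⊆ mu u x

/-- `u` is a τ⋆-cover: some family `J ⊆ mu u '' X` of infinite subsets of `ℕ`,
linearly preordered by `⊆*`, refines `mu u '' X`. -/
def IsTauStarCover {X : Type*} (u : ℕ → Set X) : Prop :=
  ∃ J : Set (Set ℕ), J ⊆ Set.range (mu u) ∧ (∀ A ∈ J, A.Infinite) ∧ LinearAlmost J ∧
    ∀ x : X, ∃ A ∈ J, A ⊆ mu u x

/-- An open cover of the whole space. -/
def IsOpenCover {X : Type*} [TopologicalSpace X] (u : Set (Set X)) : Prop :=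
  (∀ U ∈ u, IsOpen U) ∧ ⋃₀ u = Set.univ

/-- The selection principle `Ufin(O, P)` : for every sequence of open covers `u n`
there are finite `v n ⊆ u n` such that the sequence `n ↦ ⋃₀ v n` satisfies `P`. -/
def Ufin (X : Type*) [TopologicalSpace X] (P : (ℕ → Set X) → Prop) : Prop :=
  ∀ u : ℕ → Set (Set X), (∀ n, IsOpenCover (u n)) →
    ∃ v : ℕ → Set (Set X), (∀ n, (v n).Finite ∧ v n ⊆ u n) ∧ P (fun n => ⋃₀ v n)

/-- The Menger property `Ufin(O,O)`. -/
def UfinO (X : Type*) [TopologicalSpace X] : Prop :=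
  Ufin X (fun w => ∀ x : X, ∃ n, x ∈ w n)

/-- The Hurewicz property `Ufin(O,Γ)`. -/
def UfinGamma (X : Type*) [TopologicalSpace X] : Prop := Ufin X IsGammaCover

/-- `Ufin(O,Ω)`. -/
def UfinOmega (X : Type*) [TopologicalSpace X] : Prop := Ufin X IsOmegaCover

/-- `Ufin(O,T)`. -/
def UfinTau (X : Type*) [TopologicalSpace X] : Prop := Ufin X IsTauCover

/-- `Ufin(O,T*)`. -/
def UfinTauAst (X : Type*) [TopologicalSpace X] : Prop := Ufin X IsTauAstCover

/-- `Ufin(O,T⋆)`. -/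
def UfinTauStar (X : Type*) [TopologicalSpace X] : Prop := Ufin X IsTauStarCover

/-- The upward `⊆*`-closure of a family of subsets of `ℕ`. -/
def upCl (A : Set (Set ℕ)) : Set (Set ℕ) := {B | ∃ a ∈ A, AlmostSub a B}

/-- A semifilter on `ℕ`. -/
def IsSemifilter (F : Set (Set ℕ)) : Prop :=
  (∀ A ∈ F, A.Nonempty) ∧ ∀ A ∈ F, ∀ B : Set ℕ, AlmostSub A B → B ∈ F

/-- A filter on `ℕ` (in the semifilter sense): a semifilter closed under finite
intersections. -/
def IsFilterFam (F : Set (Set ℕ)) : Prop :=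
  IsSemifilter F ∧ ∀ A ∈ F, ∀ B ∈ F, A ∩ B ∈ F

/-- A simple P-filter: a filter consisting of infinite sets with a base linearly
preordered by `⊆*`. -/
def IsSimplePFilter (F : Set (Set ℕ)) : Prop :=
  IsFilterFam F ∧ (∀ A ∈ F, A.Infinite) ∧
  ∃ B : Set (Set ℕ), B ⊆ F ∧ F = upCl B ∧ LinearAlmost B

/-- A family of subsets of `ℕ` is meager if the corresponding set of
characteristic functions is meager in the Cantor space `ℕ → Bool`. -/
def MeagerFam (F : Set (Set ℕ)) : Prop :=
  IsMeagre {f : ℕ → Bool | {n | f n = true} ∈ F}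

/-- A family of subsets of `ℕ` is comeager if the corresponding set of
characteristic functions is comeager in the Cantor space `ℕ → Bool`. -/
def ComeagerFam (F : Set (Set ℕ)) : Prop :=
  {f : ℕ → Bool | {n | f n = true} ∈ F} ∈ residual (ℕ → Bool)

/-- `x ≤* y` : eventual dominance. -/
def evLE (x y : ℕ → ℕ) : Prop := {n | y n < x n}.Finite

/-- The unbounding number `𝔟`. -/
noncomputable def cardB : Cardinal :=
  sInf {c | ∃ S : Set (ℕ → ℕ), c = #S ∧ ¬ ∃ y : ℕ → ℕ, ∀ x ∈ S, evLE x y}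

/-- The dominating number `𝔡`. -/
noncomputable def cardD : Cardinal :=
  sInf {c | ∃ S : Set (ℕ → ℕ), c = #S ∧ ∀ x : ℕ → ℕ, ∃ y ∈ S, evLE x y}

/-- The ultrafilter number `𝔲`. -/
noncomputable def cardU : Cardinal :=
  sInf {c | ∃ (U : Ultrafilter ℕ) (B : Set (Set ℕ)), c = #B ∧
    (∀ A ∈ U, A.Infinite) ∧ (∀ b ∈ B, b ∈ U) ∧ ∀ A ∈ U, ∃ b ∈ B, b ⊆ A}

/-- A groupwise dense family of infinite subsets of `ℕ`. -/
def IsGroupwiseDense (G : Set (Set ℕ)) : Prop :=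
  (∀ A ∈ G, A.Infinite) ∧
  (∀ A ∈ G, ∀ B : Set ℕ, B.Infinite → B ⊆ A → B ∈ G) ∧
  ∀ k : ℕ → ℕ, StrictMono k →
    ∃ S : Set ℕ, S.Infinite ∧ (⋃ n ∈ S, Set.Ico (k n) (k (n + 1))) ∈ G

/-- The groupwise density number `𝔤`. -/
noncomputable def cardG : Cardinal :=
  sInf {c | ∃ 𝒢 : Set (Set (Set ℕ)), c = #𝒢 ∧ (∀ G ∈ 𝒢, IsGroupwiseDense G) ∧ ⋂₀ 𝒢 = ∅}

/-- A tower of length `lam`: a `⊆*`-decreasing transfinite sequence of infinite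
subsets of `ℕ` indexed by the ordinals below `lam`. -/
def IsTower (lam : Ordinal) (T : Ordinal → Set ℕ) : Prop :=
  (∀ α < lam, (T α).Infinite) ∧
  ∀ β α : Ordinal, β ≤ α → α < lam → AlmostSub (T α) (T β)

/-- `Depth⁺([ω]^{ℵ₀})`: the least cardinal `κ` such that there is no tower of
length `κ`. -/
noncomputable def depthPlus : Cardinal :=
  sInf {c : Cardinal | ¬ ∃ T : Ordinal → Set ℕ, IsTower c.ord T}

/-- The tower number `𝔱`: the least length of a tower with no infinite
pseudo-intersection. -/
noncomputable def cardT : Cardinal :=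
  sInf {c : Cardinal | ∃ T : Ordinal → Set ℕ, IsTower c.ord T ∧
    ¬ ∃ A : Set ℕ, A.Infinite ∧ ∀ α < c.ord, AlmostSub A (T α)}

/-- The trace of a family on the intervals determined by `k`. -/
def intervalTrace (k : ℕ → ℕ) (F : Set (Set ℕ)) : Set (Set ℕ) :=
  {S | ∃ A ∈ F, S = {n | (A ∩ Set.Ico (k n) (k (n + 1))).Nonempty}}

/-- The Filter Dichotomy principle. -/
def FilterDichotomy : Prop :=
  ∀ F U : Set (Set ℕ), IsFilterFam F → IsFilterFam U →
    ¬ MeagerFam F → ¬ ComeagerFam F → ¬ MeagerFam U → ¬ ComeagerFam U →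
    ∃ k : ℕ → ℕ, StrictMono k ∧ intervalTrace k F = intervalTrace k U

/-- `B` is `u`-bounded: `B` is contained in the union of a finite subfamily of `u`. -/
def BoundedBy {X : Type*} (u : Set (Set X)) (B : Set X) : Prop :=
  ∃ v : Set (Set X), v ⊆ u ∧ v.Finite ∧ B ⊆ ⋃₀ v

/-- The weak excluded middle property of a subset of the Baire space. -/
def WeakExcludedMiddle (Z : Set (ℕ → ℕ)) : Prop :=
  ∃ x : ℕ → ℕ, ∃ F : Set (Set ℕ), IsSimplePFilter F ∧ ∀ z ∈ Z, {n | z n ≤ x n} ∈ F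

/-- A nonempty open subset of the Cantor space contains a basic cylinder. -/
lemma exists_forall_agree_mem {U : Set (ℕ → Bool)} (hU : IsOpen U) {f : ℕ → Bool} (hf : f ∈ U) :
    ∃ m, ∀ h : ℕ → Bool, (∀ i < m, h i = f i) → h ∈ U := by
  obtain ⟨I, u, hu, hsub⟩ := isOpen_pi_iff.1 hU f hf
  refine ⟨I.sup id + 1, fun h hh => hsub fun i hi => ?_⟩
  have hle : i ≤ I.sup id := Finset.le_sup (f := id) hi
  rw [hh i (by omega)]
  exact (hu i hi).2

/-- Flipping the coordinates in `g`, a homeomorphism of the Cantor space. -/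
def flipOn (g : Finset ℕ) : (ℕ → Bool) ≃ₜ (ℕ → Bool) where
  toFun f i := xor (f i) (decide (i ∈ g))
  invFun f i := xor (f i) (decide (i ∈ g))
  left_inv f := by ext i; simp
  right_inv f := by ext i; simp
  continuous_toFun := continuous_pi fun i =>
    (continuous_of_discreteTopology (f := fun b : Bool => xor b (decide (i ∈ g)))).comp
      (continuous_apply i)
  continuous_invFun := continuous_pi fun i =>
    (continuous_of_discreteTopology (f := fun b : Bool => xor b (decide (i ∈ g)))).comp
      (continuous_apply i)

/-- For a dense open set `U` in the Cantor space, membership in `U` can be forced by a finite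
pattern lying beyond any given coordinate. -/
lemma exists_pattern_forall_mem {U : Set (ℕ → Bool)} (hU : IsOpen U) (hd : Dense U) (k : ℕ) :
    ∃ (m : ℕ) (f : ℕ → Bool), k < m ∧
      ∀ h : ℕ → Bool, (∀ i ∈ Ico k m, h i = f i) → h ∈ U := by
  let P : Set (Finset ℕ) := (Finset.range k).powerset
  have hPfin : P.Finite := Finset.finite_toSet _
  have ho : ∀ g ∈ P, IsOpen (flipOn g ⁻¹' U) := fun g _ => hU.preimage (flipOn g).continuous
  have hdense : Dense (⋂ g ∈ P, flipOn g ⁻¹' U) :=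
    dense_biInter_of_isOpen ho hPfin.countable fun g _ => hd.preimage (flipOn g).isOpenMap
  obtain ⟨f, hf⟩ := hdense.nonempty
  obtain ⟨m, hm⟩ := exists_forall_agree_mem (hPfin.isOpen_biInter ho) hf
  refine ⟨max m (k + 1), f, by omega, fun h hh => ?_⟩
  let g : Finset ℕ := {i ∈ Finset.range k | h i ≠ f i}
  have hg : flipOn g h ∈ ⋂ g ∈ P, flipOn g ⁻¹' U := by
    refine hm _ fun i hi => ?_
    change xor (h i) (decide (i ∈ g)) = f i
    by_cases hik : i < k
    · cases hhi : h i <;> cases hfi : f i <;> simp [g, hik, hhi, hfi]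
    · have := hh i ⟨by omega, by omega⟩
      simp [g, this]
  have hgP : g ∈ P := Finset.mem_coe.2 (Finset.mem_powerset.2 (Finset.filter_subset _ _))
  have hmem : flipOn g (flipOn g h) ∈ U := mem_iInter₂.1 hg g hgP
  have hinv : flipOn g (flipOn g h) = h := (flipOn g).left_inv h
  rwa [hinv] at hmem

/-- A residual set contains the intersection of a decreasing sequence of dense open sets. -/
lemma exists_antitone_dense_open {X : Type*} [TopologicalSpace X] [BaireSpace X] {s : Set X}
    (hs : s ∈ residual X) :
    ∃ V : ℕ → Set X, (∀ n, IsOpen (V n)) ∧ (∀ n, Dense (V n)) ∧ Antitone V ∧ ⋂ n, V n ⊆ s := by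
  obtain ⟨S, hSo, hSd, hSc, hSs⟩ := mem_residual_iff.1 hs
  obtain ⟨U, hU⟩ := (hSc.insert Set.univ).exists_eq_range (insert_nonempty _ _)
  have hmem : ∀ i, U i = Set.univ ∨ U i ∈ S := fun i => by
    have : U i ∈ insert Set.univ S := hU ▸ mem_range_self i
    simpa using this
  have hUo : ∀ i, IsOpen (U i) := fun i =>
    (hmem i).elim (fun h => h ▸ isOpen_univ) (hSo _)
  have hUd : ∀ i, Dense (U i) := fun i =>
    (hmem i).elim (fun h => h ▸ dense_univ) (hSd _)
  refine ⟨fun n => ⋂ i ∈ Iic n, U i, fun n => (finite_Iic n).isOpen_biInter fun i _ => hUo i,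
    fun n => dense_biInter_of_isOpen (fun i _ => hUo i) (to_countable _) fun i _ => hUd i,
    fun m n hmn => biInter_subset_biInter_left (Iic_subset_Iic.2 hmn),
    fun x hx => hSs fun t ht => ?_⟩
  obtain ⟨i, rfl⟩ : t ∈ range U := hU ▸ mem_insert_of_mem _ ht
  exact mem_iInter₂.1 (mem_iInter.1 hx i) i (mem_Iic.2 le_rfl)

/-- Talagrand's theorem: for a meager upward closed family there is an interval partition of `ℕ`
such that each member of the family meets all but finitely many of the intervals. -/
lemma MeagerFam.exists_strictMono {F : Set (Set ℕ)} (hF : MeagerFam F)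
    (hup : ∀ A ∈ F, ∀ B, A ⊆ B → B ∈ F) :
    ∃ k : ℕ → ℕ, StrictMono k ∧
      ∀ A ∈ F, {n | Disjoint A (Ico (k n) (k (n + 1)))}.Finite := by
  obtain ⟨V, hVo, hVd, hVa, hVF⟩ := exists_antitone_dense_open hF
  choose m f hm hf using fun n k => exists_pattern_forall_mem (hVo n) (hVd n) k
  let k : ℕ → ℕ := fun n => Nat.rec 0 m n
  have hk : StrictMono k := strictMono_nat_of_lt_succ fun n => hm n (k n)
  refine ⟨k, hk, fun A hA => ?_⟩
  by_contra hinf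
  let B : Set ℕ := A ∪ {i | ∃ n, i ∈ Ico (k n) (k (n + 1)) ∧ f n (k n) i = true}
  obtain ⟨h, hB⟩ : ∃ h : ℕ → Bool, ∀ i, h i = true ↔ i ∈ B :=
    ⟨fun i => @decide _ (Classical.propDecidable (i ∈ B)), fun i => by simp⟩
  have hhV : h ∈ ⋂ n, V n := mem_iInter.2 fun n => by
    obtain ⟨l, hl, hnl⟩ := Set.Infinite.exists_gt hinf n
    refine hVa hnl.le (hf l (k l) h fun i hi => ?_)
    have hiA : i ∉ A := fun hiA => disjoint_left.1 hl hiA hi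
    have hiB : i ∈ B ↔ f l (k l) i = true := by
      refine ⟨?_, fun hfi => Or.inr ⟨l, hi, hfi⟩⟩
      rintro (hiA' | ⟨n', hn', hfi⟩)
      · exact absurd hiA' hiA
      · have : n' = l := by_contra fun hne =>
          disjoint_left.1 (hk.monotone.pairwise_disjoint_on_Ico_succ hne) hn' hi
        rwa [← this]
    exact Bool.eq_iff_iff.2 ((hB i).trans hiB)
  refine hVF hhV ?_
  have : {n | h n = true} = B := Set.ext hB
  change {n | h n = true} ∈ F
  rw [this]
  exact hup A hA B subset_union_left

/-- The family of cofinite sets is meager. -/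
lemma meagerFam_cofinite : MeagerFam {B : Set ℕ | Bᶜ.Finite} := by
  have hN : ∀ k : ℕ, IsNowhereDense {f : ℕ → Bool | ∀ n, k ≤ n → f n = true} := fun k => by
    have hc : IsClosed {f : ℕ → Bool | ∀ n, k ≤ n → f n = true} := by
      simp only [Set.ofPred_forall]
      exact isClosed_iInter fun n => isClosed_iInter fun _ =>
        isClosed_singleton.preimage (continuous_apply n)
    rw [hc.isNowhereDense_iff, eq_empty_iff_forall_notMem]
    intro f hf
    obtain ⟨m, hm⟩ := exists_forall_agree_mem isOpen_interior hf
    have h := interior_subset (hm (fun i => if i < m then f i else false)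
      fun i hi => by simp [hi]) (max m k) (le_max_right _ _)
    simp at h
  refine (isMeagre_iUnion fun k => (hN k).isMeagre).mono fun f hf => ?_
  obtain ⟨b, hb⟩ := Set.Finite.bddAbove (show {n | f n = true}ᶜ.Finite from hf)
  refine mem_iUnion.2 ⟨b + 1, fun n hn => by_contra fun hfn => ?_⟩
  have := hb (show n ∈ {n | f n = true}ᶜ from hfn)
  omega

/-- The common refinement of the covers `u 0, …, u n`. -/
def meetCover {X : Type*} (u : ℕ → Set (Set X)) (n : ℕ) : Set (Set X) :=
  {W | ∃ c : ℕ → Set X, (∀ i ≤ n, c i ∈ u i) ∧ W = ⋂ i ∈ Iic n, c i}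

lemma isOpenCover_meetCover {X : Type*} [TopologicalSpace X] {u : ℕ → Set (Set X)}
    (hu : ∀ n, IsOpenCover (u n)) (n : ℕ) : IsOpenCover (meetCover u n) := by
  refine ⟨?_, eq_univ_of_forall fun x => ?_⟩
  · rintro W ⟨c, hc, rfl⟩
    exact (finite_Iic n).isOpen_biInter fun i hi => (hu i).1 _ (hc i hi)
  · have hx : ∀ i, ∃ U ∈ u i, x ∈ U := fun i => mem_sUnion.1 ((hu i).2 ▸ mem_univ x)
    choose c hc hxc using hx
    exact ⟨_, ⟨c, fun i _ => hc i, rfl⟩, mem_iInter₂.2 fun i _ => hxc i⟩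

/-- A space has the Hurewicz property iff for every sequence of open covers
there are finite subfamilies whose unions `w` generate a meager semifilter
`↑(mu w '' X)`. -/
theorem stmt_14 (X : Type*) [TopologicalSpace X] :
    UfinGamma X ↔
      Ufin X (fun w => MeagerFam {B : Set ℕ | ∃ x : X, AlmostSub (mu w x) B}) := by
  constructor
  · intro H u hu
    obtain ⟨v, hv, hγ⟩ := H u hu
    refine ⟨v, hv, IsMeagre.mono ?_ meagerFam_cofinite⟩
    rintro f ⟨x, hx⟩
    refine ((hγ x).union hx).subset fun n hn => ?_
    by_cases h : n ∈ mu (fun n => ⋃₀ v n) x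
    · exact Or.inr ⟨h, hn⟩
    · exact Or.inl h
  · intro H u hu
    obtain ⟨v, hv, hmeager⟩ := H _ (isOpenCover_meetCover hu)
    obtain ⟨k, hk, hkF⟩ := hmeager.exists_strictMono fun A ⟨x, hx⟩ B hAB =>
      ⟨x, hx.subset (sdiff_subset_sdiff_right hAB)⟩
    have hc : ∀ m W, ∃ c : ℕ → Set X, W ∈ v m → (∀ i ≤ m, c i ∈ u i ∧ W ⊆ c i) := by
      intro m W
      by_cases hW : W ∈ v m
      · obtain ⟨c, hc, rfl⟩ := (hv m).2 hW
        exact ⟨c, fun _ i hi => ⟨hc i hi, biInter_subset_of_mem hi⟩⟩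
      · exact ⟨fun _ => ∅, fun h => absurd h hW⟩
    choose c hc using hc
    refine ⟨fun n => ⋃ m ∈ Ico (k n) (k (n + 1)), (fun W => c m W n) '' v m, fun n => ⟨?_, ?_⟩,
      fun x => ?_⟩
    · exact (finite_Ico _ _).biUnion fun m _ => (hv m).1.image _
    · refine iUnion₂_subset fun m hm => ?_
      rintro _ ⟨W, hW, rfl⟩
      exact (hc m W hW n ((hk.le_apply).trans hm.1)).1
    · refine (hkF (mu (fun n => ⋃₀ v n) x) ⟨x, by simp [AlmostSub]⟩).subset fun n hn => ?_
      refine disjoint_left.2 fun m hxm hm => hn ?_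
      obtain ⟨W, hW, hxW⟩ := hxm
      exact ⟨c m W n, mem_biUnion hm ⟨W, hW, rfl⟩,
        (hc m W hW n ((hk.le_apply).trans hm.1)).2 hxW⟩
end

section
/- Assume 𝔟 < 𝔡. Then for every subspace Y of the Baire space ℕ^ℕ with |Y| ≤ 𝔟 and every continuous map f : Y → ℕ^ℕ, the image f(Y) has the weak excluded middle property. -/
open Set Cardinal

theorem exists_evLE_of_mk_lt_cardB {S : Set (ℕ → ℕ)} (hS : #S < cardB) :
    ∃ y : ℕ → ℕ, ∀ x ∈ S, evLE x y := by
  by_contra hne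
  exact notMem_of_lt_csInf' hS ⟨S, rfl, hne⟩

theorem exists_not_evLE_of_mk_lt_cardD {S : Set (ℕ → ℕ)} (hS : #S < cardD) :
    ∃ x : ℕ → ℕ, ∀ y ∈ S, ¬ evLE x y := by
  by_contra! hne
  exact notMem_of_lt_csInf' hS ⟨S, rfl, hne⟩

theorem AlmostSub.refl (A : Set ℕ) : AlmostSub A A := by simp [AlmostSub]

theorem AlmostSub.trans {A B C : Set ℕ} (hAB : AlmostSub A B) (hBC : AlmostSub B C) :
    AlmostSub A C :=
  (hAB.union hBC).subset fun n hn => by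
    by_cases hB : n ∈ B
    · exact Or.inr ⟨hB, hn.2⟩
    · exact Or.inl ⟨hn.1, hB⟩

theorem AlmostSub.inter {A B C : Set ℕ} (hB : AlmostSub A B) (hC : AlmostSub A C) :
    AlmostSub A (B ∩ C) :=
  (hB.union hC).subset fun n hn => by
    by_cases h : n ∈ B
    · exact Or.inr ⟨hn.1, fun h' => hn.2 ⟨h, h'⟩⟩
    · exact Or.inl ⟨hn.1, h⟩

theorem AlmostSub.infinite {A B : Set ℕ} (h : AlmostSub A B) (hA : A.Infinite) : B.Infinite :=
  fun hB => hA ((h.union hB).subset fun n hn => by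
    by_cases hn' : n ∈ B
    · exact Or.inr hn'
    · exact Or.inl ⟨hn, hn'⟩)

/-- A linearly preordered family of infinite sets generates a simple P-filter. -/
theorem LinearAlmost.isSimplePFilter_upCl {J : Set (Set ℕ)} (hJ : LinearAlmost J)
    (hinf : ∀ A ∈ J, A.Infinite) : IsSimplePFilter (upCl J) := by
  have hup : ∀ A ∈ upCl J, A.Infinite := by
    rintro A ⟨a, ha, haA⟩
    exact haA.infinite (hinf a ha)
  refine ⟨⟨⟨fun A hA => (hup A hA).nonempty, ?_⟩, ?_⟩, hup, J,
    fun A hA => ⟨A, hA, .refl A⟩, rfl, hJ⟩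
  · rintro A ⟨a, ha, haA⟩ B hAB
    exact ⟨a, ha, haA.trans hAB⟩
  · rintro A ⟨a, ha, haA⟩ B ⟨b, hb, hbB⟩
    rcases hJ a ha b hb with hab | hba
    · exact ⟨a, ha, haA.inter (hab.trans hbB)⟩
    · exact ⟨b, hb, (hba.trans haA).inter hbB⟩

theorem evLE.almostSub_setOf_le {y z : ℕ → ℕ} (h : evLE y z) (x : ℕ → ℕ) :
    AlmostSub {n | z n ≤ x n} {n | y n ≤ x n} :=
  h.subset fun n hn => by
    simp only [mem_sdiff, mem_ofPred_eq, not_le] at hn ⊢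
    omega

/-- A family of at most `𝔟` functions is dominated termwise by a `≤*`-linearly ordered family. -/
theorem exists_evLE_chain {ι : Type} (hι : #ι ≤ cardB) (g : ι → ℕ → ℕ) :
    ∃ b : ι → ℕ → ℕ, (∀ i, evLE (g i) (b i)) ∧ ∀ i j, evLE (b i) (b j) ∨ evLE (b j) (b i) := by
  classical
  obtain ⟨r, hr, hord⟩ := Cardinal.exists_ord_eq ι
  let bound : Set (ℕ → ℕ) → ℕ → ℕ := fun S =>
    if hS : ∃ y : ℕ → ℕ, ∀ x ∈ S, evLE x y then hS.choose else 0
  have hbound : ∀ S : Set (ℕ → ℕ), #S < cardB → ∀ x ∈ S, evLE x (bound S) := by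
    intro S hS
    have hex := exists_evLE_of_mk_lt_cardB hS
    simp only [bound, dif_pos hex]
    exact hex.choose_spec
  have hwf : WellFounded r := hr.wf
  let step : ∀ i, (∀ j, r j i → ℕ → ℕ) → ℕ → ℕ := fun i b n =>
    max (g i n) (bound (range fun j : {j // r j i} => b j.1 j.2) n)
  let b : ι → ℕ → ℕ := hwf.fix step
  have hb : ∀ i n, b i n = max (g i n) (bound (range fun j : {j // r j i} => b j.1) n) := by
    intro i n
    exact congrFun (hwf.fix_eq step i) n
  have hlt : ∀ i j, r j i → evLE (b j) (b i) := by
    intro i j hji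
    have hcard : #(range fun j : {j // r j i} => b j.1) < cardB :=
      (mk_range_le.trans_lt (Cardinal.card_typein_lt i hord)).trans_le hι
    refine (hbound _ hcard (b j) ⟨⟨j, hji⟩, rfl⟩).subset fun n hn => ?_
    simp only [mem_ofPred_eq] at hn ⊢
    rw [hb i n] at hn
    exact (le_max_right _ _).trans_lt hn
  refine ⟨b, fun i => ?_, fun i j => ?_⟩
  · have hempty : {n | b i n < g i n} = ∅ := by
      ext n
      simp [hb i n]
    simp [evLE, hempty]
  · rcases trichotomous_of r i j with hij | rfl | hji
    · exact Or.inl (hlt j i hij)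
    · exact Or.inl (by simp [evLE])
    · exact Or.inr (hlt i j hji)

/-- If `𝔟 < 𝔡`, then every continuous image in the Baire space of a subspace of
the Baire space of size at most `𝔟` has the weak excluded middle property. -/
theorem stmt_18 (h : cardB < cardD) (Y : Set (ℕ → ℕ)) (hY : #Y ≤ cardB)
    (f : Y → ℕ → ℕ) (hf : Continuous f) :
    WeakExcludedMiddle (Set.range f) := by
  obtain ⟨b, hfb, hb⟩ := exists_evLE_chain hY f
  obtain ⟨x, hx⟩ := exists_not_evLE_of_mk_lt_cardD ((mk_range_le (f := b)).trans_lt (hY.trans_lt h))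
  refine ⟨x, upCl (range fun i => {n | b i n ≤ x n}),
    LinearAlmost.isSimplePFilter_upCl ?_ ?_, ?_⟩
  · rintro _ ⟨i, rfl⟩ _ ⟨j, rfl⟩
    exact (hb j i).imp (fun hji => hji.almostSub_setOf_le x) fun hij => hij.almostSub_setOf_le x
  · rintro _ ⟨i, rfl⟩
    exact Set.Infinite.mono (fun n (hn : b i n < x n) => hn.le) (hx _ (mem_range_self i))
  · rintro _ ⟨i, rfl⟩
    exact ⟨_, mem_range_self i, (hfb i).almostSub_setOf_le x⟩
end
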